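/- Let l be the length function on S̃_n (defined by l(ω^a w) = l(w) for w ∈ W, where l on the affine Weyl group W of type Ã_{n-1} is the Coxeter length). For x_i = τ_1⋯τ_i and a simple reflection s_j (1 ≤ j ≤ n-1), one has l(x_i s_j) = l(x_i) - 1 if and only if i = j. -/

import Mathlib

/-- The weight lattice `X` of the diagonal torus of `SL_n(ℂ)`:
the quotient of `ℤ^n` by the span of the constant vector `(1,…,1)`,
so that the images `τ_1, …, τ_n` of the standard basis vectors satisfy
`τ_1 + ⋯ + τ_n = 0` (multiplicatively, `τ_1 ⋯ τ_n = 1`). -/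
abbrev Xlat (n : ℕ) : Type :=
  (Fin n → ℤ) ⧸ AddSubgroup.zmultiples (1 : Fin n → ℤ)

/-- The additive automorphism of `ℤ^n` permuting the coordinates by `w`. -/
def permV (n : ℕ) (w : Equiv.Perm (Fin n)) : (Fin n → ℤ) ≃+ (Fin n → ℤ) where
  toFun v := v ∘ w.symm
  invFun v := v ∘ w
  left_inv v := by ext i; simp
  right_inv v := by ext i; simp
  map_add' _ _ := rfl

lemma permV_const (n : ℕ) (w : Equiv.Perm (Fin n)) :
    (AddSubgroup.zmultiples (1 : Fin n → ℤ)).map (permV n w) =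
      AddSubgroup.zmultiples (1 : Fin n → ℤ) := by
  ext v
  simp only [AddSubgroup.mem_map, AddSubgroup.mem_zmultiples_iff]
  constructor
  · rintro ⟨y, ⟨k, hk⟩, rfl⟩
    exact ⟨k, by subst hk; ext i; simp [permV]⟩
  · rintro ⟨k, hk⟩
    exact ⟨v, ⟨k, hk⟩, by subst hk; ext i; simp [permV]⟩

/-- The induced action of `S_n` on the lattice `X`. -/
def permX (n : ℕ) (w : Equiv.Perm (Fin n)) : Xlat n ≃+ Xlat n :=
  QuotientAddGroup.congr _ _ (permV n w) (permV_const n w)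

lemma permX_mk (n : ℕ) (w : Equiv.Perm (Fin n)) (v : Fin n → ℤ) :
    permX n w (QuotientAddGroup.mk v) = QuotientAddGroup.mk (v ∘ w.symm) :=
  rfl

/-- The action of `S_n` on (the multiplicative version of) `X`, as a group homomorphism
into the automorphism group. -/
def permAct (n : ℕ) : Equiv.Perm (Fin n) →* MulAut (Multiplicative (Xlat n)) where
  toFun w := AddEquiv.toMultiplicative (permX n w)
  map_one' := by
    ext x
    induction x using QuotientAddGroup.induction_on with
    | H v => simp [AddEquiv.toMultiplicative, permX_mk]; rfl
  map_mul' w u := by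
    ext x
    induction x using QuotientAddGroup.induction_on with
    | H v => simp [AddEquiv.toMultiplicative, permX_mk]; rfl

/-- The extended affine symmetric group `S̃_n = S_n ⋉ X`. -/
abbrev AffSn (n : ℕ) : Type :=
  SemidirectProduct (Multiplicative (Xlat n)) (Equiv.Perm (Fin n)) (permAct n)

/-- The element `τ_i` of `S̃_n`, `i = 1, …, n` (0-indexed here). -/
def tau (n : ℕ) (i : Fin n) : AffSn n :=
  SemidirectProduct.inl (Multiplicative.ofAdd
    (QuotientAddGroup.mk (Pi.single i 1) : Xlat n))

/-- The copy of a finite permutation inside `S̃_n`. -/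
def fperm (n : ℕ) (w : Equiv.Perm (Fin n)) : AffSn n := SemidirectProduct.inr w


/-- `⟨i mod n⟩` as an element of `Fin n`. -/
def finOf (n : ℕ) [NeZero n] (i : ℕ) : Fin n := ⟨i % n, Nat.mod_lt _ (NeZero.pos n)⟩

/-- The element `τ_i` of `S̃_n` where `i` is a 0-indexed natural number
(so `tauN n 0, …, tauN n (n-1)` are `τ_1, …, τ_n` of the paper). -/
def tauN (n : ℕ) [NeZero n] (i : ℕ) : AffSn n := tau n (finOf n i)

/-- The simple reflection `s_j = (j, j+1)` of `S_n` (1-indexed: `j = 1, …, n-1`),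
written 0-indexed as the swap of `j-1` and `j`. -/
def sNp (n : ℕ) [NeZero n] (j : ℕ) : Equiv.Perm (Fin n) :=
  Equiv.swap (finOf n (j - 1)) (finOf n j)

/-- The finite simple reflection `s_j` viewed inside `S̃_n` (1-indexed). -/
def sfin (n : ℕ) [NeZero n] (j : ℕ) : AffSn n := fperm n (sNp n j)

/-- The affine simple reflection `s_0 = s·τ_1^2 τ_2 ⋯ τ_{n-1}`, where `s = (1,n)`. -/
def s0 (n : ℕ) [NeZero n] : AffSn n :=
  fperm n (Equiv.swap (finOf n 0) (finOf n (n - 1))) * tauN n 0 *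
    ((List.range (n - 1)).map (tauN n)).prod

/-- The element `ω = τ_1 s_1 s_2 ⋯ s_{n-1}` of `S̃_n`. -/
def om (n : ℕ) [NeZero n] : AffSn n :=
  tauN n 0 * ((List.range (n - 1)).map (fun i => sfin n (i + 1))).prod

/-- The simple reflections `s_0, s_1, …, s_{n-1}` of the affine Weyl group,
indexed by `Fin n` (with `s_0` the affine reflection). -/
def saff (n : ℕ) [NeZero n] (i : Fin n) : AffSn n :=
  if (i : ℕ) = 0 then s0 n else sfin n i

/-- The element `x_i = τ_1 τ_2 ⋯ τ_i` of `S̃_n` (so `xel n i` for `1 ≤ i ≤ n-1`). -/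
def xel (n : ℕ) [NeZero n] (i : ℕ) : AffSn n :=
  ((List.range i).map (tauN n)).prod

/-- The length function on the extended affine symmetric group
`S̃_n = Ω ⋉ W`: `l(ω^a w) = l(w)` where `l` on the affine Weyl group `W`
(generated by `s_0, …, s_{n-1}`) is the Coxeter length, realized as the minimal
length of a word in the generators `s_0, …, s_{n-1}`. -/
noncomputable def lenT (n : ℕ) [NeZero n] (g : AffSn n) : ℕ :=
  sInf {m | ∃ (a : ℤ) (l : List (Fin n)),
    l.length = m ∧ g = om n ^ a * (l.map (saff n)).prod}

/-- Explicit element of the group. -/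
def EE (n : ℕ) (v : Fin n → ℤ) (w : Equiv.Perm (Fin n)) : AffSn n :=
  ⟨Multiplicative.ofAdd (QuotientAddGroup.mk v : Xlat n), w⟩

lemma EE_mul (n : ℕ) (v v' : Fin n → ℤ) (w w' : Equiv.Perm (Fin n)) :
    EE n v w * EE n v' w' = EE n (v + v' ∘ w.symm) (w * w') := rfl

lemma EE_one (n : ℕ) : EE n 0 1 = 1 := rfl

lemma EE_eq_iff (n : ℕ) (v v' : Fin n → ℤ) (w w' : Equiv.Perm (Fin n)) :
    EE n v w = EE n v' w' ↔ (∃ c : ℤ, ∀ a, v' a = v a + c) ∧ w = w' := by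
  have h1 : EE n v w = EE n v' w' ↔
      ((QuotientAddGroup.mk v : Xlat n) = QuotientAddGroup.mk v') ∧ w = w' := by
    constructor
    · intro h
      exact ⟨congrArg (fun g : AffSn n => Multiplicative.toAdd g.left) h,
        congrArg (fun g : AffSn n => g.right) h⟩
    · rintro ⟨h, rfl⟩
      unfold EE
      rw [h]
  rw [h1, QuotientAddGroup.eq, AddSubgroup.mem_zmultiples_iff]
  refine and_congr_left fun _ => exists_congr fun c => ?_
  constructor
  · intro h a
    have := congrFun h a
    simp at this
    omega
  · intro h
    ext a
    simp [h a]

lemma fperm_eq (n : ℕ) (w : Equiv.Perm (Fin n)) : fperm n w = EE n 0 w := rfl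

lemma tau_eq (n : ℕ) (i : Fin n) : tau n i = EE n (Pi.single i 1) 1 := rfl

lemma finOf_val (n : ℕ) [NeZero n] (i : ℕ) (h : i < n) : (finOf n i : ℕ) = i :=
  Nat.mod_eq_of_lt h

/-- Indicator of the first `m` coordinates. -/
def indV (n m : ℕ) : Fin n → ℤ := fun k => if (k : ℕ) < m then 1 else 0

lemma xel_eq (n : ℕ) [NeZero n] (m : ℕ) (hm : m ≤ n) : xel n m = EE n (indV n m) 1 := by
  induction m with
  | zero =>
    have : indV n 0 = 0 := by ext k; simp [indV]
    rw [this]; rfl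
  | succ m ih =>
    have h1 : xel n (m + 1) = xel n m * tauN n m := by
      simp [xel, List.range_succ]
    rw [h1, ih (by omega), tauN, tau_eq, EE_mul, mul_one]
    congr 1
    ext k
    have := finOf_val n m (by omega)
    simp only [indV, Pi.add_apply, Function.comp_apply, Pi.single_apply, Fin.ext_iff, this]
    have e : (Equiv.symm (1 : Equiv.Perm (Fin n))) k = k := rfl
    rw [e]
    split_ifs <;> omega

/-- Partial cycles. -/
def cyc (n : ℕ) [NeZero n] (m : ℕ) : Equiv.Perm (Fin n) :=
  ((List.range m).map (fun i => sNp n (i + 1))).prod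

lemma prod_sfin (n : ℕ) [NeZero n] (m : ℕ) :
    ((List.range m).map (fun i => sfin n (i + 1))).prod = EE n 0 (cyc n m) := by
  induction m with
  | zero => rfl
  | succ m ih =>
    have h : cyc n (m + 1) = cyc n m * sNp n (m + 1) := by simp [cyc, List.range_succ]
    rw [List.range_succ, List.map_append, List.prod_append, ih, h]
    simp only [List.map_cons, List.map_nil, List.prod_cons, List.prod_nil, mul_one, sfin, fperm_eq,
      EE_mul]
    congr 1

lemma cyc_val (n : ℕ) [NeZero n] (m : ℕ) (hm : m + 1 ≤ n) (k : Fin n) :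
    (cyc n m k : ℕ) = if (k : ℕ) < m then (k : ℕ) + 1 else if (k : ℕ) = m then 0 else k := by
  induction m generalizing k with
  | zero =>
    simp [cyc]
  | succ m ih =>
    have h : cyc n (m + 1) = cyc n m * sNp n (m + 1) := by simp [cyc, List.range_succ]
    have h1 := finOf_val n m (by omega)
    have h2 := finOf_val n (m + 1) (by omega)
    rw [h, Equiv.Perm.mul_apply, ih (by omega), sNp]
    simp only [Nat.add_sub_cancel, Equiv.swap_apply_def]
    by_cases ha : k = finOf n m
    · rw [if_pos ha]; subst ha; simp [h1, h2]
    · rw [if_neg ha]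
      have ha' : (k : ℕ) ≠ m := fun e => ha (Fin.ext (by rw [e, h1]))
      by_cases hb : k = finOf n (m + 1)
      · rw [if_pos hb]; subst hb; simp [h1, h2]
      · rw [if_neg hb]
        have hb' : (k : ℕ) ≠ m + 1 := fun e => hb (Fin.ext (by rw [e, h2]))
        split_ifs <;> omega

lemma om_eq (n : ℕ) [NeZero n] : om n = EE n (indV n 1) (cyc n (n - 1)) := by
  have hn := NeZero.pos n
  have h0 := finOf_val n 0 hn
  rw [om, prod_sfin, tauN, tau_eq, EE_mul, one_mul]
  congr 1
  ext k
  simp only [indV, Pi.add_apply, Function.comp_apply, Pi.single_apply, Fin.ext_iff, h0]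
  simp

lemma cyc_pow (n : ℕ) [NeZero n] (i : ℕ) (k : Fin n) :
    ((cyc n (n - 1) ^ i) k : ℕ) = (k + i) % n := by
  have hn := NeZero.pos n
  induction i with
  | zero => simp [Nat.mod_eq_of_lt k.2]
  | succ i ih =>
    rw [pow_succ', Equiv.Perm.mul_apply, cyc_val n (n - 1) (by omega), ih]
    have := Nat.mod_lt (k + i) hn
    rw [← Nat.add_assoc, ← Nat.mod_add_mod (k + i) n 1]
    generalize ((k : ℕ) + i) % n = r at *
    split_ifs with h1 h2
    · rw [Nat.mod_eq_of_lt (by omega)]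
    · rw [h2, Nat.sub_add_cancel (by omega), Nat.mod_self]
    · omega

lemma om_pow (n : ℕ) [NeZero n] (i : ℕ) (hi : i ≤ n) :
    om n ^ i = EE n (indV n i) (cyc n (n - 1) ^ i) := by
  have hn := NeZero.pos n
  induction i with
  | zero =>
    have : indV n 0 = 0 := by ext k; simp [indV]
    rw [this]; rfl
  | succ i ih =>
    rw [pow_succ, ih (by omega), om_eq, EE_mul, ← pow_succ]
    congr 1
    ext k
    have h := cyc_pow n i ((cyc n (n - 1) ^ i).symm k)
    rw [Equiv.apply_symm_apply] at h
    simp only [indV, Pi.add_apply, Function.comp_apply]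
    generalize ((cyc n (n - 1) ^ i).symm k) = l at *
    have hl := l.2
    have : ((l : ℕ) + i) % n = if (l : ℕ) + i < n then (l : ℕ) + i else (l : ℕ) + i - n := by
      split_ifs with hh
      · exact Nat.mod_eq_of_lt hh
      · rw [Nat.mod_eq_sub_mod (by omega), Nat.mod_eq_of_lt (by omega)]
    rw [this] at h
    split_ifs at * <;> omega

lemma om_pow_n (n : ℕ) [NeZero n] : om n ^ n = 1 := by
  rw [om_pow n n le_rfl, ← EE_one, EE_eq_iff]
  refine ⟨⟨-1, fun a => by simp [indV]⟩, ?_⟩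
  ext k
  rw [cyc_pow]
  simp [Nat.mod_eq_of_lt k.2]

/-- One term of the affine inversion count. -/
def TT {n : ℕ} (v : Fin n → ℤ) (q : Equiv.Perm (Fin n)) (a b : Fin n) : ℕ :=
  (v b - v a - if q b < q a then 1 else 0).natAbs

/-- The affine inversion count. -/
def FF {n : ℕ} (v : Fin n → ℤ) (w : Equiv.Perm (Fin n)) : ℕ :=
  ∑ p ∈ (Finset.univ : Finset (Fin n × Fin n)).filter (fun p => p.1 < p.2),
    TT v w.symm p.1 p.2

lemma FF_step {n : ℕ} (v v' : Fin n → ℤ) (w w' : Equiv.Perm (Fin n)) (a0 b0 : Fin n)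
    (hab : a0 < b0)
    (h : ∀ a b, a < b → ¬ (a = a0 ∧ b = b0) → TT v' w'.symm a b = TT v w.symm a b) :
    FF v' w' + TT v w.symm a0 b0 = FF v w + TT v' w'.symm a0 b0 := by
  have hm : (a0, b0) ∈ (Finset.univ : Finset (Fin n × Fin n)).filter (fun p => p.1 < p.2) := by
    simpa using hab
  unfold FF
  rw [← Finset.add_sum_erase _ _ hm, ← Finset.add_sum_erase _ _ hm]
  have : ∀ p ∈ ((Finset.univ : Finset (Fin n × Fin n)).filter (fun p => p.1 < p.2)).erase (a0, b0),
      TT v' w'.symm p.1 p.2 = TT v w.symm p.1 p.2 := by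
    rintro ⟨a, b⟩ hp
    simp at hp
    exact h a b hp.2 (fun e => hp.1 e.1 e.2)
  rw [Finset.sum_congr rfl this]
  dsimp only
  omega

lemma swap_lt_swap {n : ℕ} (x y k l : Fin n) (hxy : (x : ℕ) + 1 = y) (hkl : k ≠ l)
    (h1 : ¬ (k = x ∧ l = y)) (h2 : ¬ (k = y ∧ l = x)) :
    (Equiv.swap x y k < Equiv.swap x y l) ↔ k < l := by
  simp only [Equiv.swap_apply_def, Fin.lt_def, Fin.ext_iff, ne_eq] at *
  split_ifs <;> omega

lemma FF_fin {n : ℕ} (v : Fin n → ℤ) (w : Equiv.Perm (Fin n)) (x y a0 b0 : Fin n)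
    (hxy : (x : ℕ) + 1 = y) (hab : a0 < b0)
    (h : (w x = a0 ∧ w y = b0) ∨ (w x = b0 ∧ w y = a0)) :
    FF v (w * Equiv.swap x y) + TT v w.symm a0 b0 =
      FF v w + TT v (w * Equiv.swap x y).symm a0 b0 := by
  apply FF_step _ _ _ _ _ _ hab
  intro a b hlt hne
  have e : ∀ a, (w * Equiv.swap x y).symm a = Equiv.swap x y (w.symm a) := fun a => rfl
  unfold TT
  rw [e, e]
  have : (Equiv.swap x y (w.symm b) < Equiv.swap x y (w.symm a)) ↔ w.symm b < w.symm a := by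
    apply swap_lt_swap _ _ _ _ hxy
    · intro h; exact hlt.ne (w.symm.injective h).symm
    · rintro ⟨h1, h2⟩
      rw [Equiv.symm_apply_eq] at h1 h2
      subst h1 h2
      grind
    · rintro ⟨h1, h2⟩
      rw [Equiv.symm_apply_eq] at h1 h2
      subst h1 h2
      grind
  simp only [this]

lemma FF_fin_le {n : ℕ} (v : Fin n → ℤ) (w : Equiv.Perm (Fin n)) (x y : Fin n)
    (hxy : (x : ℕ) + 1 = y) : FF v (w * Equiv.swap x y) ≤ FF v w + 1 := by
  have hne : w x ≠ w y := fun h => by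
    have := w.injective h; subst this; omega
  rcases lt_or_gt_of_ne hne with hlt | hlt
  · have := FF_fin v w x y _ _ hxy hlt (Or.inl ⟨rfl, rfl⟩)
    unfold TT at this
    split_ifs at this <;> omega
  · have := FF_fin v w x y _ _ hxy hlt (Or.inr ⟨rfl, rfl⟩)
    unfold TT at this
    split_ifs at this <;> omega

lemma FF_fin_up {n : ℕ} (w : Equiv.Perm (Fin n)) (x y : Fin n)
    (hxy : (x : ℕ) + 1 = y) (hlt : w x < w y) :
    FF 0 (w * Equiv.swap x y) = FF 0 w + 1 := by
  have := FF_fin 0 w x y _ _ hxy hlt (Or.inl ⟨rfl, rfl⟩)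
  have e : ∀ a, (w * Equiv.swap x y).symm a = Equiv.swap x y (w.symm a) := fun a => rfl
  have h1 : ¬ (y < x) := by rw [Fin.lt_def]; omega
  have h2 : x < y := by rw [Fin.lt_def]; omega
  simpa [TT, e, h1, h2] using this

lemma FF_fin_down {n : ℕ} (w : Equiv.Perm (Fin n)) (x y : Fin n)
    (hxy : (x : ℕ) + 1 = y) (hlt : w y < w x) :
    FF 0 (w * Equiv.swap x y) + 1 = FF 0 w := by
  have := FF_fin 0 w x y _ _ hxy hlt (Or.inr ⟨rfl, rfl⟩)
  have e : ∀ a, (w * Equiv.swap x y).symm a = Equiv.swap x y (w.symm a) := fun a => rfl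
  have h1 : ¬ (y < x) := by rw [Fin.lt_def]; omega
  have h2 : x < y := by rw [Fin.lt_def]; omega
  simpa [TT, e, h1, h2] using this

lemma s0_eq (n : ℕ) [NeZero n] (hn : 2 ≤ n) :
    s0 n = EE n (Pi.single (finOf n (n - 1)) 1 - Pi.single (finOf n 0) 1)
      (Equiv.swap (finOf n 0) (finOf n (n - 1))) := by
  have h0 := finOf_val n 0 (by omega)
  have h1 := finOf_val n (n - 1) (by omega)
  have : s0 n = fperm n (Equiv.swap (finOf n 0) (finOf n (n - 1))) * tauN n 0 *
    xel n (n - 1) := rfl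
  rw [this, xel_eq n (n - 1) (by omega), fperm_eq, tauN, tau_eq, EE_mul, EE_mul, EE_eq_iff]
  refine ⟨⟨-1, fun a => ?_⟩, by simp⟩
  have ha := a.2
  simp only [indV, Pi.add_apply, Pi.sub_apply, Function.comp_apply, Pi.single_apply,
    Equiv.symm_swap, mul_one, Pi.zero_apply, Equiv.swap_apply_def, Fin.ext_iff, h0, h1]
  split_ifs <;> omega

lemma FF_s0_le {n : ℕ} (v : Fin n → ℤ) (w : Equiv.Perm (Fin n)) (x y : Fin n)
    (hx : (x : ℕ) = 0) (hy : (y : ℕ) + 1 = n) (hn : 2 ≤ n) :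
    FF (v + (Pi.single y 1 - Pi.single x 1) ∘ w.symm) (w * Equiv.swap x y) ≤ FF v w + 1 := by
  have hxy : x ≠ y := by intro h; subst h; omega
  have hne : w x ≠ w y := fun h => hxy (w.injective h)
  have e : ∀ a, (w * Equiv.swap x y).symm a = Equiv.swap x y (w.symm a) := fun a => rfl
  have key : ∀ a0 b0, a0 < b0 → ((w x = a0 ∧ w y = b0) ∨ (w x = b0 ∧ w y = a0)) →
      FF (v + (Pi.single y 1 - Pi.single x 1) ∘ w.symm) (w * Equiv.swap x y) +
        TT v w.symm a0 b0 = FF v w +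
        TT (v + (Pi.single y 1 - Pi.single x 1) ∘ w.symm) (w * Equiv.swap x y).symm a0 b0 := by
    intro a0 b0 hab h
    apply FF_step _ _ _ _ _ _ hab
    intro a b hlt hne
    have hkl : w.symm a ≠ w.symm b := fun h => hlt.ne (w.symm.injective h)
    have hn1 : ¬ (w.symm a = x ∧ w.symm b = y) := by
      rintro ⟨h1, h2⟩
      rw [Equiv.symm_apply_eq] at h1 h2
      subst h1 h2
      grind
    have hn2 : ¬ (w.symm a = y ∧ w.symm b = x) := by
      rintro ⟨h1, h2⟩
      rw [Equiv.symm_apply_eq] at h1 h2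
      subst h1 h2
      grind
    unfold TT
    rw [e, e]
    congr 1
    simp only [Pi.add_apply, Pi.sub_apply, Function.comp_apply, Pi.single_apply,
      Equiv.swap_apply_def]
    generalize w.symm a = k at *
    generalize w.symm b = l at *
    have hk := k.2
    have hl := l.2
    simp only [Fin.lt_def, Fin.ext_iff, ne_eq] at *
    split_ifs <;> omega
  have t1 : x < y := by rw [Fin.lt_def]; have : (x : ℕ) ≠ y := fun h => hxy (Fin.ext h); omega
  have t2 : ¬ y < x := not_lt.2 t1.le
  rcases lt_or_gt_of_ne hne with hlt | hlt
  · have := key _ _ hlt (Or.inl ⟨rfl, rfl⟩)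
    simp only [TT, e, Pi.add_apply, Pi.sub_apply, Function.comp_apply, Pi.single_apply,
      Equiv.symm_apply_apply, Equiv.swap_apply_left, Equiv.swap_apply_right, t1, t2, hxy, hxy.symm,
      if_true, if_false] at this
    omega
  · have := key _ _ hlt (Or.inr ⟨rfl, rfl⟩)
    simp only [TT, e, Pi.add_apply, Pi.sub_apply, Function.comp_apply, Pi.single_apply,
      Equiv.symm_apply_apply, Equiv.swap_apply_left, Equiv.swap_apply_right, t1, t2, hxy, hxy.symm,
      if_true, if_false] at this
    omega

lemma FF_one {n : ℕ} : FF (0 : Fin n → ℤ) 1 = 0 := by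
  unfold FF
  apply Finset.sum_eq_zero
  rintro ⟨a, b⟩ h
  simp at h
  have : ¬ b < a := not_lt.2 h.le
  have e : ∀ c : Fin n, (Equiv.symm (1 : Equiv.Perm (Fin n))) c = c := fun _ => rfl
  simp [TT, e, h.le]

lemma word_bound (n : ℕ) [NeZero n] (hn : 2 ≤ n) (l : List (Fin n)) :
    ∃ v w, (l.map (saff n)).prod = EE n v w ∧ FF v w ≤ l.length ∧ ∑ a, v a = 0 := by
  induction l using List.reverseRecOn with
  | nil => exact ⟨0, 1, rfl, by simp [FF_one], by simp⟩
  | append_singleton l i ih =>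
    obtain ⟨v, w, h1, h2, h3⟩ := ih
    simp only [List.map_append, List.prod_append, h1, List.map_cons, List.map_nil, List.prod_cons,
      List.prod_nil, mul_one, List.length_append, List.length_singleton, saff]
    by_cases hi : (i : ℕ) = 0
    · rw [if_pos hi, s0_eq n hn, EE_mul]
      refine ⟨_, _, rfl, ?_, ?_⟩
      · refine (FF_s0_le v w _ _ (finOf_val n 0 (by omega)) ?_ hn).trans (by omega)
        rw [finOf_val n (n - 1) (by omega)]; omega
      · simp only [Pi.add_apply, Finset.sum_add_distrib, h3, zero_add, Function.comp_apply]
        refine (Equiv.sum_comp w.symm _).trans ?_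
        simp
    · rw [if_neg hi, sfin, fperm_eq, EE_mul]
      have hi' := i.2
      refine ⟨_, _, rfl, ?_, ?_⟩
      · have : v + (0 : Fin n → ℤ) ∘ w.symm = v := by ext; simp
        rw [this]
        refine (FF_fin_le v w _ _ ?_).trans (by omega)
        rw [finOf_val n _ (by omega), finOf_val n _ (by omega)]; omega
      · simpa using h3

lemma FF_const {n : ℕ} (v : Fin n → ℤ) (w : Equiv.Perm (Fin n)) (c : ℤ) (h : ∀ a, v a = c) :
    FF v w = FF 0 w := by
  simp [FF, TT, h]

lemma sum_indV (n r : ℕ) (h : r ≤ n) : ∑ a, indV n r a = r := by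
  have : ∑ a : Fin n, indV n r a = ∑ a ∈ Finset.range n, if a < r then (1:ℤ) else 0 :=
    Fin.sum_univ_eq_sum_range (fun a => if a < r then (1:ℤ) else 0) n
  rw [this, ← Finset.sum_filter]
  have h2 : (Finset.range n).filter (fun a => a < r) = Finset.range r := by
    ext a; simp; omega
  rw [h2]; simp

lemma len_lower (n : ℕ) [NeZero n] (hn : 2 ≤ n) (i : ℕ) (u : Equiv.Perm (Fin n)) (a : ℤ)
    (l : List (Fin n)) (h : om n ^ i * fperm n u = om n ^ a * (l.map (saff n)).prod) :
    FF 0 u ≤ l.length := by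
  obtain ⟨v, w, h1, h2, h3⟩ := word_bound n hn l
  rw [h1, fperm_eq] at h
  have h4 : EE n v w = om n ^ ((i : ℤ) - a) * EE n 0 u := by
    rw [sub_eq_neg_add, zpow_add, mul_assoc, zpow_natCast, h, zpow_neg, inv_mul_cancel_left]
  have hn0 : (0 : ℤ) < n := by omega
  obtain ⟨r, hr⟩ : ∃ r : ℕ, (r : ℤ) = ((i : ℤ) - a) % n :=
    ⟨(((i : ℤ) - a) % n).toNat, Int.toNat_of_nonneg (Int.emod_nonneg _ hn0.ne')⟩
  have hrn : (r : ℤ) < n := hr ▸ Int.emod_lt_of_pos _ hn0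
  have h5 : om n ^ ((i : ℤ) - a) = om n ^ r := by
    rw [← Int.emod_add_mul_ediv ((i : ℤ) - a) n, zpow_add, zpow_mul, zpow_natCast (om n) n,
      om_pow_n, one_zpow, mul_one, ← hr, zpow_natCast]
  rw [h5, om_pow n r (by omega), EE_mul, EE_eq_iff] at h4
  obtain ⟨⟨c, hc⟩, hw⟩ := h4
  have hc' : ∀ a, indV n r a = v a + c := fun a => by simpa using hc a
  have hs := sum_indV n r (by omega)
  simp only [hc', Finset.sum_add_distrib, h3] at hs
  simp at hs
  have hc0 : c = 0 := by
    rcases lt_trichotomy c 0 with hlt | heq | hgt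
    · nlinarith
    · exact heq
    · nlinarith
  subst hc0
  have hr0 : r = 0 := by
    have : (r : ℤ) = 0 := by rw [← hs]; simp
    exact_mod_cast this
  subst hr0
  have hv : ∀ a, v a = 0 := fun a => by have := hc' a; simp [indV] at this; omega
  rw [FF_const v w 0 hv] at h2
  simpa [hw] using h2

lemma exists_word (n : ℕ) [NeZero n] (m : ℕ) : ∀ (u : Equiv.Perm (Fin n)), FF 0 u = m →
    ∃ l : List (Fin n), l.length = m ∧ fperm n u = (l.map (saff n)).prod := by
  induction m using Nat.strong_induction_on with
  | _ m ih =>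
    intro u hu
    by_cases hd : ∃ x y : Fin n, (x : ℕ) + 1 = y ∧ u y < u x
    · obtain ⟨x, y, hxy, hlt⟩ := hd
      have h := FF_fin_down u x y hxy hlt
      obtain ⟨l, hl1, hl2⟩ := ih (m - 1) (by omega) (u * Equiv.swap x y) (by omega)
      refine ⟨l ++ [y], by simp; omega, ?_⟩
      have hy : saff n y = fperm n (Equiv.swap x y) := by
        rw [saff, if_neg (by omega), sfin, sNp]
        have e1 : finOf n ((y : ℕ) - 1) = x := Fin.ext (by rw [finOf_val n _ (by omega)]; omega)
        have e2 : finOf n (y : ℕ) = y := Fin.ext (by rw [finOf_val n _ (by omega)])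
        rw [e1, e2]
      rw [List.map_append, List.prod_append, ← hl2]
      simp only [List.map_cons, List.map_nil, List.prod_cons, List.prod_nil, mul_one, hy]
      unfold fperm
      rw [← map_mul, mul_assoc, Equiv.swap_mul_self, mul_one]
    · push Not at hd
      have hmono : StrictMono u := by
        obtain ⟨k, rfl⟩ : ∃ k, n = k + 1 := ⟨n - 1, by have := NeZero.pos n; omega⟩
        rw [Fin.strictMono_iff_lt_succ]
        intro i
        refine lt_of_le_of_ne (hd _ _ (by simp)) ?_
        intro h
        have := u.injective h
        simp [Fin.ext_iff] at this
      have hu1 : u = 1 := by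
        have h2 : (u : Fin n → Fin n) = id :=
          (StrictMono.range_inj hmono strictMono_id).1 (by simp [u.surjective.range_eq])
        ext k; simp [h2]
      subst hu1
      rw [FF_one] at hu
      exact ⟨[], by simpa using hu, rfl⟩

lemma lenT_eq (n : ℕ) [NeZero n] (hn : 2 ≤ n) (i : ℕ) (u : Equiv.Perm (Fin n)) :
    lenT n (om n ^ i * fperm n u) = FF 0 u := by
  apply le_antisymm
  · apply Nat.sInf_le
    obtain ⟨l, h1, h2⟩ := exists_word n _ u rfl
    exact ⟨i, l, h1, by rw [← h2, zpow_natCast]⟩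
  · apply le_csInf
    · obtain ⟨l, h1, h2⟩ := exists_word n _ u rfl
      exact ⟨_, i, l, h1, by rw [← h2, zpow_natCast]⟩
    · rintro m ⟨a, l, rfl, h⟩
      exact len_lower n hn i u a l h

/-- For `x_i = τ_1 ⋯ τ_i` and a finite simple reflection `s_j` (`1 ≤ i, j ≤ n-1`),
one has `l(x_i s_j) = l(x_i) - 1` if and only if `i = j`, where `l` is the length
function on the extended affine symmetric group `S̃_n`. -/
theorem len_x_mul_s (n : ℕ) [NeZero n] (hn : 2 ≤ n) (i j : ℕ)
    (hi1 : 1 ≤ i) (hi2 : i ≤ n - 1) (hj1 : 1 ≤ j) (hj2 : j ≤ n - 1) :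
    lenT n (xel n i * sfin n j) = lenT n (xel n i) - 1 ↔ i = j := by
  set u : Equiv.Perm (Fin n) := (cyc n (n - 1) ^ i)⁻¹ with hu
  have hx : xel n i = om n ^ i * fperm n u := by
    rw [xel_eq n i (by omega), om_pow n i (by omega), fperm_eq, EE_mul, hu, mul_inv_cancel]
    congr 1
    ext; simp
  have hxs : xel n i * sfin n j = om n ^ i * fperm n (u * sNp n j) := by
    rw [hx, mul_assoc, sfin]; unfold fperm; rw [map_mul]
  rw [hxs, hx, lenT_eq n hn, lenT_eq n hn, sNp]
  have f1 := finOf_val n (j - 1) (by omega)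
  have f2 := finOf_val n j (by omega)
  have hxy : (finOf n (j - 1) : ℕ) + 1 = finOf n j := by omega
  have huv : ∀ k : Fin n, (u k : ℕ) = if (k : ℕ) < i then (k : ℕ) + n - i else (k : ℕ) - i := by
    intro k
    have h := cyc_pow n i (u k)
    have h' : (cyc n (n - 1) ^ i) (u k) = k := by rw [hu]; simp
    rw [h'] at h
    have hk := k.2
    have hl := (u k).2
    generalize (u k : ℕ) = l at *
    have : (l + i) % n = if l + i < n then l + i else l + i - n := by
      split_ifs with hh
      · exact Nat.mod_eq_of_lt hh
      · rw [Nat.mod_eq_sub_mod (by omega), Nat.mod_eq_of_lt (by omega)]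
    rw [this] at h
    split_ifs at * <;> omega
  constructor
  · intro h
    by_contra hij
    have hlt : u (finOf n (j - 1)) < u (finOf n j) := by
      rw [Fin.lt_def, huv, huv, f1, f2]
      split_ifs <;> omega
    have := FF_fin_up u _ _ hxy hlt
    omega
  · rintro rfl
    have hlt : u (finOf n i) < u (finOf n (i - 1)) := by
      rw [Fin.lt_def, huv, huv, f1, f2]
      split_ifs <;> omega
    have := FF_fin_down u _ _ hxy hlt
    omega
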